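/- The automorphism group Aut(W(2)) is isomorphic as a group to the one-dimensional affine group over F, i.e., to the group of 2×2 matrices of the form [[1, a], [0, b]] with a ∈ F and b ∈ F* under matrix multiplication. -/

import Mathlib

noncomputable section

variable (F : Type*) [Field F] [CharZero F]

abbrev V2 (F : Type*) [Field F] : Type _ := Fin 2 → F

abbrev WW (F : Type*) [Field F] : Type _ := V2 F →ₗ[F] V2 F →ₗ[F] V2 F

def vone : V2 F := ![1, 0]

/-- The multiplication on the space of bilinear maps. -/
def wmul (A B : WW F) : WW F :=
  LinearMap.mk₂ F
    (fun x y => A (vone F) (B x y) - B (A (vone F) x) y - B x (A (vone F) y))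
    (fun x x' y => by simp only [map_add, LinearMap.add_apply]; abel)
    (fun c x y => by simp only [map_smul, LinearMap.smul_apply, smul_sub])
    (fun x y y' => by simp only [map_add, LinearMap.add_apply]; abel)
    (fun c x y => by simp only [map_smul, LinearMap.smul_apply, smul_sub])

/-- α_{ij}^k -/
def alphaM (i j k : Fin 2) : WW F :=
  LinearMap.mk₂ F (fun x y => (x i * y j) • (Pi.single k (1 : F) : V2 F))
    (fun x x' y => by simp [add_mul, add_smul])
    (fun c x y => by simp [smul_smul, mul_assoc])
    (fun x y y' => by simp [mul_add, add_smul])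
    (fun c x y => by simp [smul_smul, mul_assoc, mul_left_comm])

/-- The basis e₁, …, e₈ of W(2) (indexed 0,…,7). -/
def bE : Fin 8 → WW F :=
  ![alphaM F 0 0 0 - alphaM F 0 1 1 - alphaM F 1 0 1,
    alphaM F 0 0 1,
    alphaM F 1 1 1 - alphaM F 0 1 0 - alphaM F 1 0 0,
    alphaM F 1 1 0,
    (2 : F) • alphaM F 0 0 0 + alphaM F 0 1 1 + alphaM F 1 0 1,
    (2 : F) • alphaM F 1 1 1 + alphaM F 0 1 0 + alphaM F 1 0 0,
    alphaM F 0 1 0 - alphaM F 1 0 0,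
    alphaM F 0 1 1 - alphaM F 1 0 1]


/-- The group of algebra automorphisms of W(2). -/
def AutW : Type _ :=
  {g : WW F ≃ₗ[F] WW F // ∀ A B, g (wmul F A B) = wmul F (g A) (g B)}

instance : Group (AutW F) where
  one := ⟨LinearEquiv.refl F (WW F), fun _ _ => rfl⟩
  mul g h := ⟨h.1.trans g.1, fun A B => by
    simp only [LinearEquiv.trans_apply, h.2, g.2]⟩
  inv g := ⟨g.1.symm, fun A B => g.1.injective (by
    rw [LinearEquiv.apply_symm_apply, g.2, LinearEquiv.apply_symm_apply,
      LinearEquiv.apply_symm_apply])⟩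
  mul_assoc a b c := rfl
  one_mul a := Subtype.ext (LinearEquiv.trans_refl a.1)
  mul_one a := Subtype.ext (LinearEquiv.refl_trans a.1)
  inv_mul_cancel a := Subtype.ext (LinearEquiv.self_trans_symm a.1)

/-- The one-dimensional affine group over F, realized as the group of 2×2 matrices
of the form [[1, a], [0, b]] with b invertible. -/
def AffGroup : Subgroup (Matrix (Fin 2) (Fin 2) F)ˣ where
  carrier := {M | (M : Matrix (Fin 2) (Fin 2) F) 0 0 = 1 ∧
    (M : Matrix (Fin 2) (Fin 2) F) 1 0 = 0}
  one_mem' := by constructor <;> simp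
  mul_mem' := by
    rintro a b ⟨ha1, ha2⟩ ⟨hb1, hb2⟩
    constructor <;>
      simp [Units.val_mul, Matrix.mul_apply, Fin.sum_univ_two, ha1, ha2, hb1, hb2]
  inv_mem' := by
    rintro a ⟨ha1, ha2⟩
    have h : ((a⁻¹ : (Matrix (Fin 2) (Fin 2) F)ˣ) : Matrix (Fin 2) (Fin 2) F) *
        (a : Matrix (Fin 2) (Fin 2) F) = 1 := a.inv_mul
    constructor
    · have h00 : (((a⁻¹ : (Matrix (Fin 2) (Fin 2) F)ˣ) : Matrix (Fin 2) (Fin 2) F) *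
          (a : Matrix (Fin 2) (Fin 2) F)) 0 0 = (1 : Matrix (Fin 2) (Fin 2) F) 0 0 := by
        rw [h]
      simpa [Matrix.mul_apply, Fin.sum_univ_two, ha1, ha2, Matrix.one_apply] using h00
    · have h10 : (((a⁻¹ : (Matrix (Fin 2) (Fin 2) F)ˣ) : Matrix (Fin 2) (Fin 2) F) *
          (a : Matrix (Fin 2) (Fin 2) F)) 1 0 = (1 : Matrix (Fin 2) (Fin 2) F) 1 0 := by
        rw [h]
      simpa [Matrix.mul_apply, Fin.sum_univ_two, ha1, ha2, Matrix.one_apply] using h10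

section

variable (K : Type*) [Field K]

/-- The bilinear map `(x, y) ↦ xᵢ • a y`. -/
def coordSMul (i : Fin 2) (a : V2 K →ₗ[K] V2 K) : WW K :=
  (LinearMap.proj i : V2 K →ₗ[K] K).smulRight a

@[simp] theorem coordSMul_apply (i : Fin 2) (a : V2 K →ₗ[K] V2 K) (x y : V2 K) :
    coordSMul K i a x y = x i • a y := rfl

@[simp] theorem wmul_apply (A B : WW K) (x y : V2 K) :
    wmul K A B x y =
      A (vone K) (B x y) - B (A (vone K) x) y - B x (A (vone K) y) := rfl

@[simp] theorem vone_zero : vone K 0 = 1 := rfl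

@[simp] theorem vone_one : vone K 1 = 0 := rfl

variable {K}

theorem eq_smul_vone_add (x : V2 K) : x = x 0 • vone K + x 1 • Pi.single 1 1 := by
  ext i; fin_cases i <;> simp

/-- Left multiplication by `A` depends only on `A(v₁, ·)`, and faithfully so. -/
theorem left_eq_of_wmul_eq {A A' : WW K} (h : ∀ B, wmul K A B = wmul K A' B) :
    A (vone K) = A' (vone K) := by
  refine LinearMap.ext fun x => funext fun i => ?_
  have hB := LinearMap.congr_fun₂ (h (coordSMul K i LinearMap.id)) x (vone K)
  simpa using congrFun hB 0

theorem wmul_congr_left {A A' : WW K} (h : A (vone K) = A' (vone K)) (B : WW K) :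
    wmul K A B = wmul K A' B := by
  refine LinearMap.ext₂ fun x y => ?_
  simp only [wmul_apply, h]

namespace AutW

/-- The underlying linear equivalence of an automorphism. -/
def toLin (g : AutW K) : WW K ≃ₗ[K] WW K := g.1

theorem ext {g g' : AutW K} (h : ∀ A x y, g.toLin A x y = g'.toLin A x y) : g = g' :=
  Subtype.ext (LinearEquiv.ext fun A => LinearMap.ext₂ (h A))

theorem map_wmul (g : AutW K) (A B : WW K) :
    g.toLin (wmul K A B) = wmul K (g.toLin A) (g.toLin B) :=
  g.2 A B

/-- The map induced by an automorphism on operators `A(v₁, ·)`. -/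
def opMap (g : AutW K) : (V2 K →ₗ[K] V2 K) →ₗ[K] (V2 K →ₗ[K] V2 K) where
  toFun a := g.toLin (coordSMul K 0 a) (vone K)
  map_add' a b := by
    rw [← LinearMap.add_apply, ← map_add]; congr 2
    refine LinearMap.ext₂ fun x y => ?_
    simp
  map_smul' c a := by
    rw [RingHom.id_apply, ← LinearMap.smul_apply, ← map_smul]; congr 2
    refine LinearMap.ext₂ fun x y => ?_
    simp [smul_smul, mul_comm]

theorem left_eq_iff (g : AutW K) (A A' : WW K) :
    g.toLin A (vone K) = g.toLin A' (vone K) ↔ A (vone K) = A' (vone K) := by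
  constructor <;> intro h <;> apply left_eq_of_wmul_eq <;> intro B
  · apply g.toLin.injective
    rw [map_wmul, map_wmul, wmul_congr_left h]
  · obtain ⟨B, rfl⟩ := g.toLin.surjective B
    rw [← map_wmul, ← map_wmul, wmul_congr_left h]

theorem apply_vone (g : AutW K) (A : WW K) : g.toLin A (vone K) = opMap g (A (vone K)) :=
  (left_eq_iff g _ _).2 (LinearMap.ext fun y => by simp)

theorem opMap_injective (g : AutW K) : Function.Injective (opMap g) := by
  intro a b h
  have := (left_eq_iff g _ _).1 h
  refine LinearMap.ext fun y => ?_
  simpa using LinearMap.congr_fun this y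

theorem opMap_id (g : AutW K) : opMap g LinearMap.id = LinearMap.id := by
  have key : g.toLin (coordSMul K 0 LinearMap.id) (vone K) =
      coordSMul K 0 LinearMap.id (vone K) := by
    apply left_eq_of_wmul_eq
    have hneg (B : WW K) : wmul K (coordSMul K 0 LinearMap.id) B = -B := by
      refine LinearMap.ext₂ fun x y => ?_
      simp
    intro B
    obtain ⟨B, rfl⟩ := g.toLin.surjective B
    rw [← map_wmul, hneg, hneg, map_neg g.toLin]
  refine LinearMap.ext fun y => ?_
  simpa [opMap] using LinearMap.congr_fun key y

theorem opMap_comp_sub_comp (g : AutW K) (a b : V2 K →ₗ[K] V2 K) :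
    opMap g (a ∘ₗ b - b ∘ₗ a) = opMap g a ∘ₗ opMap g b - opMap g b ∘ₗ opMap g a := by
  have hbr (c d : V2 K →ₗ[K] V2 K) (B : WW K) :
      wmul K (coordSMul K 0 (c ∘ₗ d - d ∘ₗ c)) B =
        wmul K (coordSMul K 0 c) (wmul K (coordSMul K 0 d) B) -
          wmul K (coordSMul K 0 d) (wmul K (coordSMul K 0 c) B) := by
    refine LinearMap.ext₂ fun x y => ?_
    simp only [wmul_apply, coordSMul_apply, vone_zero, one_smul, LinearMap.sub_apply,
      LinearMap.comp_apply, map_sub]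
    abel
  have hg (c : V2 K →ₗ[K] V2 K) (B : WW K) :
      wmul K (coordSMul K 0 (opMap g c)) (g.toLin B) = g.toLin (wmul K (coordSMul K 0 c) B) := by
    rw [map_wmul]
    apply wmul_congr_left
    refine LinearMap.ext fun y => ?_
    simp [opMap]
  have key : coordSMul K 0 (opMap g (a ∘ₗ b - b ∘ₗ a)) (vone K) =
      coordSMul K 0 (opMap g a ∘ₗ opMap g b - opMap g b ∘ₗ opMap g a) (vone K) := by
    apply left_eq_of_wmul_eq
    intro B
    obtain ⟨B, rfl⟩ := g.toLin.surjective B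
    rw [hbr]
    simp only [hg, hbr, map_sub g.toLin]
  refine LinearMap.ext fun y => ?_
  simpa using LinearMap.congr_fun key y

theorem apply_opMap_vone (g : AutW K) (a : V2 K →ₗ[K] V2 K) (A : WW K) :
    g.toLin A (opMap g a (vone K)) = opMap g (A (a (vone K))) := by
  have h1 : wmul K (coordSMul K 0 a) A (vone K) =
      (a ∘ₗ A (vone K) - A (vone K) ∘ₗ a) - A (a (vone K)) := by
    refine LinearMap.ext fun y => ?_
    simp only [wmul_apply, coordSMul_apply, vone_zero, one_smul, LinearMap.sub_apply,
      LinearMap.comp_apply]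
    abel
  have h2 : g.toLin (wmul K (coordSMul K 0 a) A) (vone K) =
      (opMap g a ∘ₗ opMap g (A (vone K)) - opMap g (A (vone K)) ∘ₗ opMap g a) -
        g.toLin A (opMap g a (vone K)) := by
    refine LinearMap.ext fun y => ?_
    simp only [map_wmul, wmul_apply, apply_vone, LinearMap.sub_apply, LinearMap.comp_apply]
    have : coordSMul K 0 a (vone K) = a := LinearMap.ext fun y => by simp
    rw [this]; abel
  rw [apply_vone, h1, map_sub, opMap_comp_sub_comp] at h2
  exact (sub_right_injective h2).symm

theorem opMap_vone_eq_zero (g : AutW K) {a : V2 K →ₗ[K] V2 K} (ha : a (vone K) = 0) :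
    opMap g a (vone K) = 0 := by
  ext i
  obtain ⟨A, hA⟩ := g.toLin.surjective (coordSMul K i LinearMap.id)
  have h := LinearMap.congr_fun (apply_opMap_vone g a A) (vone K)
  rw [hA, ha] at h
  simpa using congrFun h 0

/-- The linear map of `V₂` that induces a given automorphism. -/
def baseMap (g : AutW K) : V2 K →ₗ[K] V2 K :=
  LinearMap.applyₗ (vone K) ∘ₗ opMap g ∘ₗ
    (LinearMap.smulRightₗ (LinearMap.proj 0 : V2 K →ₗ[K] K))

theorem opMap_apply_vone (g : AutW K) (a : V2 K →ₗ[K] V2 K) :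
    opMap g a (vone K) = baseMap g (a (vone K)) := by
  rw [← sub_eq_zero]
  change opMap g a (vone K) - opMap g _ (vone K) = 0
  rw [← LinearMap.sub_apply, ← map_sub]
  apply opMap_vone_eq_zero
  simp

theorem baseMap_vone (g : AutW K) : baseMap g (vone K) = vone K := by
  have := opMap_apply_vone g LinearMap.id
  rw [opMap_id] at this
  exact this.symm

theorem apply_baseMap (g : AutW K) (A : WW K) (x : V2 K) :
    g.toLin A (baseMap g x) = opMap g (A x) := by
  have h := apply_opMap_vone g (LinearMap.smulRight (LinearMap.proj 0 : V2 K →ₗ[K] K) x) A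
  rw [opMap_apply_vone] at h
  simpa using h

theorem baseMap_injective (g : AutW K) : Function.Injective (baseMap g) := by
  rw [injective_iff_map_eq_zero]
  intro x hx
  ext i
  have h := apply_baseMap g (coordSMul K i LinearMap.id) x
  rw [hx, map_zero, eq_comm, map_eq_zero_iff _ (opMap_injective g)] at h
  simpa using congrFun (LinearMap.congr_fun h (vone K)) 0

theorem opMap_baseMap_sub (g : AutW K) (a b : V2 K →ₗ[K] V2 K) :
    opMap g a (baseMap g (b (vone K))) - opMap g b (baseMap g (a (vone K))) =
      baseMap g (a (b (vone K)) - b (a (vone K))) := by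
  have h := LinearMap.congr_fun (opMap_comp_sub_comp g a b) (vone K)
  rw [opMap_apply_vone] at h
  simpa [opMap_apply_vone] using h.symm

theorem opMap_smulRight_baseMap [CharZero K] (g : AutW K) (x z : V2 K) :
    opMap g ((LinearMap.proj 0 : V2 K →ₗ[K] K).smulRight x) (baseMap g z) =
      baseMap g (z 0 • x) := by
  set m : V2 K →ₗ[K] V2 K →ₗ[K] V2 K :=
    LinearMap.smulRightₗ (LinearMap.proj 0 : V2 K →ₗ[K] K)
  have m_apply (x y : V2 K) : m x y = y 0 • x := rfl
  change opMap g (m x) (baseMap g z) = _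
  set w : V2 K := Pi.single 1 1 with hw
  have hw0 : w 0 = 0 := by simp [hw]
  have hv (x : V2 K) : opMap g (m x) (vone K) = baseMap g x := by
    rw [opMap_apply_vone]; simp [m_apply]
  have hPw : opMap g (m (vone K)) (baseMap g w) = 0 := by
    have h := opMap_baseMap_sub g (m (vone K)) (m w)
    simpa [m_apply, hw0, baseMap_vone, hv] using h
  have hNw : opMap g (m w) (baseMap g w) = 0 := by
    obtain ⟨q, hq⟩ := LinearMap.injective_iff_surjective.1 (baseMap_injective g)
      (opMap g (m w) (baseMap g w))
    have hbr : m (vone K) ∘ₗ m w - m w ∘ₗ m (vone K) = - m w := by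
      refine LinearMap.ext fun y => ?_
      simp [m_apply, hw0]
    have h := LinearMap.congr_fun (opMap_comp_sub_comp g (m (vone K)) (m w)) (baseMap g w)
    simp only [hbr, map_neg, LinearMap.neg_apply, LinearMap.sub_apply, LinearMap.comp_apply,
      hPw, map_zero, sub_zero, ← hq] at h
    have h' : opMap g (m (vone K)) (baseMap g q) = baseMap g (q 0 • vone K) := by
      conv_lhs => rw [eq_smul_vone_add q]
      simp [← hw, hPw, baseMap_vone, hv]
    rw [h', ← map_neg] at h
    have h := baseMap_injective g h
    have h0 := congrFun h 0
    have h1 := congrFun h 1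
    have hq0 : q = 0 := by
      ext i; fin_cases i
      · exact self_eq_neg.1 (by simpa using h0.symm)
      · simpa using h1
    rw [← hq, hq0, map_zero]
  rw [eq_smul_vone_add z, eq_smul_vone_add x]
  simp [← hw, hw0, hPw, hNw, hv, baseMap_vone, smul_comm (x _) (z 0)]

theorem opMap_baseMap [CharZero K] (g : AutW K) (a : V2 K →ₗ[K] V2 K) (y : V2 K) :
    opMap g a (baseMap g y) = baseMap g (a y) := by
  have h := opMap_baseMap_sub g a ((LinearMap.proj 0 : V2 K →ₗ[K] K).smulRight y)
  rw [opMap_smulRight_baseMap] at h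
  simpa using h

/-- The automorphism of `W(2)` induced by a linear automorphism of `V₂` fixing `v₁`. -/
def ofLinearEquiv (e : V2 K ≃ₗ[K] V2 K) (he : e (vone K) = vone K) : AutW K :=
  ⟨e.arrowCongr (e.arrowCongr e), fun A B => by
    have he' : e.symm (vone K) = vone K := by rw [LinearEquiv.symm_apply_eq, he]
    refine LinearMap.ext₂ fun x y => ?_
    simp [LinearEquiv.arrowCongr_apply, he']⟩

theorem ofLinearEquiv_apply (e : V2 K ≃ₗ[K] V2 K) (he : e (vone K) = vone K) (A : WW K)
    (x y : V2 K) : (ofLinearEquiv e he).toLin A x y = e (A (e.symm x) (e.symm y)) := rfl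

theorem exists_ofLinearEquiv_eq [CharZero K] (g : AutW K) :
    ∃ (e : V2 K ≃ₗ[K] V2 K) (he : e (vone K) = vone K), ofLinearEquiv e he = g := by
  let e := LinearEquiv.ofInjectiveEndo (baseMap g) (baseMap_injective g)
  have coe_e (x : V2 K) : e x = baseMap g x := rfl
  have he : e (vone K) = vone K := baseMap_vone g
  refine ⟨e, he, AutW.ext fun A x y => ?_⟩
  obtain ⟨x, rfl⟩ := e.surjective x
  obtain ⟨y, rfl⟩ := e.surjective y
  rw [ofLinearEquiv_apply, e.symm_apply_apply, e.symm_apply_apply, coe_e, coe_e, coe_e,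
    apply_baseMap, opMap_baseMap]

theorem ofLinearEquiv_injective {e e' : V2 K ≃ₗ[K] V2 K} {he : e (vone K) = vone K}
    {he' : e' (vone K) = vone K} (h : ofLinearEquiv e he = ofLinearEquiv e' he') : e = e' := by
  have hs : e.symm = e'.symm := by
    ext1 x
    ext i
    have h1 := LinearMap.congr_fun₂ (LinearEquiv.congr_fun (congrArg toLin h)
      (coordSMul K i LinearMap.id)) x (vone K)
    simpa [ofLinearEquiv_apply] using congrFun h1 0
  rw [← e.symm_symm, hs, e'.symm_symm]

end AutW

/-- Invertible matrices acting on `V₂`. -/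
def matrixAct : (Matrix (Fin 2) (Fin 2) K)ˣ ≃* (V2 K ≃ₗ[K] V2 K) :=
  Matrix.GeneralLinearGroup.toLin.trans
    (LinearMap.GeneralLinearGroup.generalLinearEquiv K (V2 K))

theorem matrixAct_apply (M : (Matrix (Fin 2) (Fin 2) K)ˣ) (x : V2 K) :
    matrixAct M x = (M : Matrix (Fin 2) (Fin 2) K).mulVec x := rfl

theorem mem_affGroup_iff (M : (Matrix (Fin 2) (Fin 2) K)ˣ) :
    M ∈ AffGroup K ↔ matrixAct M (vone K) = vone K := by
  change _ ∧ _ ↔ _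
  simp [matrixAct_apply, funext_iff, Fin.forall_fin_two]

/-- The affine group acting on `W(2)` by automorphisms. -/
def affGroupToAutW : AffGroup K →* AutW K where
  toFun M := AutW.ofLinearEquiv (matrixAct M.1) ((mem_affGroup_iff M.1).1 M.2)
  map_one' := by
    refine AutW.ext fun A x y => ?_
    rw [AutW.ofLinearEquiv_apply, Subgroup.coe_one, map_one]
    rfl
  map_mul' M N := by
    refine AutW.ext fun A x y => ?_
    rw [AutW.ofLinearEquiv_apply, Subgroup.coe_mul, map_mul]
    rfl

theorem affGroupToAutW_bijective [CharZero K] :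
    Function.Bijective (affGroupToAutW (K := K)) := by
  constructor
  · intro M N h
    exact Subtype.ext (matrixAct.injective (AutW.ofLinearEquiv_injective
      (he := (mem_affGroup_iff M.1).1 M.2) (he' := (mem_affGroup_iff N.1).1 N.2) h))
  · intro g
    obtain ⟨e, he, rfl⟩ := AutW.exists_ofLinearEquiv_eq g
    obtain ⟨M, rfl⟩ := matrixAct.surjective e
    exact ⟨⟨M, (mem_affGroup_iff M).2 he⟩, rfl⟩

end

/-- Aut(W(2)) is isomorphic to the one-dimensional affine group over F. -/
theorem statement14 : Nonempty (AutW F ≃* AffGroup F) :=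
  ⟨(MulEquiv.ofBijective affGroupToAutW affGroupToAutW_bijective).symm⟩

end
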